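/- arXiv:1405.5110 — 2 statements merged into one kernel-verified Lean document; each statement's English description precedes it below -/
import Mathlib

section
/- Let w : ℝ → ℝ be an even Schwartz function. For every ε > 0 there exists a constant C > 0, depending only on ε and w, such that for every positive integer N, every real X ≥ 1, and every odd positive integer n that is not a perfect square, one has |∑_{d ∈ ℤ, d squarefree, gcd(d,N)=1} w̃(d/X) · (d/n)| ≤ C · n^{1/2+ε} · (X·N)^{ε}. -/
open scoped Classical

/-- For a Schwartz function `w : ℝ → ℝ` and a positive integer `N`, the function
`w̃(x) = ∑_{n ≥ 1, gcd(n,N) = 1} w(n² x)`. -/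
noncomputable def wtilde (w : ℝ → ℝ) (N : ℕ) (x : ℝ) : ℝ :=
  ∑' n : ℕ, if 0 < n ∧ Nat.Coprime n N then w ((n : ℝ) ^ 2 * x) else 0


lemma aux_nat_sum {s : ℝ} (hs : 0 < s) :
    Summable (fun h : ℕ => s / (s ^ 2 + ((h : ℝ) + 1) ^ 2)) ∧
    ∑' h : ℕ, s / (s ^ 2 + ((h : ℝ) + 1) ^ 2) ≤ 2 := by
  have hn : ∀ h : ℕ, 0 ≤ s / (s ^ 2 + ((h : ℝ) + 1) ^ 2) := fun h => by positivity
  have key : ∀ H : ℕ, ∑ h ∈ Finset.range H, s / (s ^ 2 + ((h : ℝ) + 1) ^ 2)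
      ≤ 2 - 2 * s / (s + H) := by
    intro H
    induction H with
    | zero => simp; field_simp; norm_num
    | succ H ih =>
      rw [Finset.sum_range_succ]
      have h1 : s / (s ^ 2 + ((H : ℝ) + 1) ^ 2) ≤ 2 * s / (s + H) - 2 * s / (s + (H + 1)) := by
        have hH : (0 : ℝ) ≤ H := by positivity
        rw [div_sub_div _ _ (by positivity) (by positivity), div_le_div_iff₀ (by positivity) (by positivity)]
        have : 2 * s * (s + (H + 1)) - (s + H) * (2 * s) = 2 * s := by ring
        rw [this]
        have h3 : (s + H) * (s + (H + 1)) ≤ 2 * (s ^ 2 + ((H : ℝ) + 1) ^ 2) := by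
          nlinarith [sq_nonneg (s - (H + 1))]
        nlinarith
      push_cast
      linarith
  have key2 : ∀ H : ℕ, ∑ h ∈ Finset.range H, s / (s ^ 2 + ((h : ℝ) + 1) ^ 2) ≤ 2 := by
    intro H
    have : 0 ≤ 2 * s / (s + H) := by positivity
    linarith [key H]
  exact ⟨summable_of_sum_range_le hn key2, Real.tsum_le_of_sum_range_le hn key2⟩

noncomputable def nzf (s : ℝ) (h : ℤ) : ℝ := if h = 0 then 0 else s / (s ^ 2 + (h : ℝ) ^ 2)

lemma aux_int_sum {s : ℝ} (hs : 0 < s) :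
    Summable (nzf s) ∧ ∑' h : ℤ, nzf s h ≤ 4 := by
  obtain ⟨h1, h2⟩ := aux_nat_sum hs
  have a1 : ∀ n : ℕ, nzf s ((n : ℤ) + 1) = s / (s ^ 2 + ((n : ℝ) + 1) ^ 2) := by
    intro n
    have : (n : ℤ) + 1 ≠ 0 := by omega
    rw [nzf, if_neg this]
    push_cast; rfl
  have a2 : ∀ n : ℕ, nzf s (-((n : ℤ) + 1)) = s / (s ^ 2 + ((n : ℝ) + 1) ^ 2) := by
    intro n
    have : -((n : ℤ) + 1) ≠ 0 := by omega
    rw [nzf, if_neg this]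
    push_cast
    rw [neg_sq]
  have e := h1.hasSum
  generalize (∑' h : ℕ, s / (s ^ 2 + ((h : ℝ) + 1) ^ 2)) = T at *
  have e1 : HasSum (fun n : ℕ => nzf s ((n : ℤ) + 1)) T := by
    rw [funext a1]; exact e
  have e2 : HasSum (fun n : ℕ => nzf s (-((n : ℤ) + 1))) T := by
    rw [funext a2]; exact e
  have a3 := HasSum.of_add_one_of_neg_add_one e1 e2
  refine ⟨a3.summable, ?_⟩
  rw [a3.tsum_eq]
  have : nzf s 0 = 0 := by simp [nzf]
  linarith

lemma aux_decay (f : SchwartzMap ℝ ℂ) : ∃ C : ℝ, 0 < C ∧ ∀ x : ℝ, ‖f x‖ ≤ C / (1 + x ^ 2) := by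
  obtain ⟨C0, h0, H0⟩ := f.decay 0 0
  obtain ⟨C2, h2, H2⟩ := f.decay 2 0
  refine ⟨C0 + C2, by positivity, fun x => ?_⟩
  rw [le_div_iff₀ (by positivity)]
  have := H0 x
  have h3 := H2 x
  simp at this h3
  nlinarith

lemma aux_gauss {q : ℕ} [NeZero q] (χ : DirichletCharacter ℂ q) (hχ : χ.IsPrimitive) :
    ‖gaussSum χ ZMod.stdAddChar‖ = Real.sqrt q := by
  have hχ' : (χ⁻¹).IsPrimitive := by
    rw [DirichletCharacter.isPrimitive_def, DirichletCharacter.conductor_inv]; exact hχ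
  have h1 : ZMod.dft (ZMod.dft (⇑χ)) 1 = (q : ℂ) • χ (-1) := by
    rw [ZMod.dft_dft]
  have h2 : ZMod.dft (⇑χ) = fun k => χ⁻¹ (-k) * gaussSum χ ZMod.stdAddChar := by
    funext k; exact hχ.fourierTransform_eq_inv_mul_gaussSum k
  rw [h2, ZMod.dft_mul_const (fun k => χ⁻¹ (-k)), ZMod.dft_comp_neg] at h1
  simp only [hχ'.fourierTransform_eq_inv_mul_gaussSum] at h1
  simp only [neg_neg, map_one, one_mul, smul_eq_mul, inv_inv] at h1
  have h3 : ‖gaussSum χ⁻¹ ZMod.stdAddChar‖ = ‖gaussSum χ ZMod.stdAddChar‖ := by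
    have := gaussSum_mulShift χ⁻¹ (ZMod.stdAddChar (N := q)) (-1)
    have h4 := star_gaussSum_eq χ (ZMod.stdAddChar (N := q))
    have h5 : (ZMod.stdAddChar (N := q)).mulShift (((-1 : (ZMod q)ˣ)) : ZMod q) = ZMod.stdAddChar⁻¹ := by
      ext x; simp [AddChar.mulShift_apply, AddChar.inv_apply]
    rw [h5, ← h4] at this
    rw [← this, norm_mul, DirichletCharacter.unit_norm_eq_one, one_mul, norm_star]
  have h4 := congrArg norm h1
  rw [norm_mul, h3, norm_mul] at h4
  have h5 : ‖χ (-1)‖ = 1 := by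
    have := DirichletCharacter.unit_norm_eq_one χ (-1); simpa using this
  rw [h5, mul_one, Complex.norm_natCast] at h4
  rw [← h4, Real.sqrt_mul_self (norm_nonneg _)]

noncomputable def dil (f : SchwartzMap ℝ ℂ) (s : ℝ) (hs : s ≠ 0) : SchwartzMap ℝ ℂ :=
  SchwartzMap.compCLMOfContinuousLinearEquiv ℂ (ContinuousLinearEquiv.unitsEquivAut ℝ (Units.mk0 s hs)) f

lemma dil_apply (f : SchwartzMap ℝ ℂ) (s : ℝ) (hs : s ≠ 0) (x : ℝ) : dil f s hs x = f (x * s) := by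
  simp [dil]

open FourierTransform in
lemma dil_fourier (f : SchwartzMap ℝ ℂ) (s : ℝ) (hs : 0 < s) (x : ℝ) :
    (𝓕 (dil f s hs.ne')) x = (s⁻¹ : ℝ) • (𝓕 f) (x / s) := by
  rw [SchwartzMap.fourier_coe, SchwartzMap.fourier_coe, Real.fourier_real_eq_integral_exp_smul,
    Real.fourier_real_eq_integral_exp_smul]
  have := MeasureTheory.Measure.integral_comp_mul_left
    (fun v : ℝ => Complex.exp (↑(-2 * Real.pi * v * (x / s)) * Complex.I) • f v) s
  rw [abs_of_pos (inv_pos.2 hs)] at this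
  rw [← this]
  congr 1
  ext v
  rw [dil_apply, mul_comm v s]
  congr 4
  field_simp

lemma aux_triv {f : ℝ → ℂ} {C : ℝ} (hf : ∀ x : ℝ, ‖f x‖ ≤ C / (1 + x ^ 2)) {t : ℝ} (ht : 0 < t)
    {g : ℤ → ℂ} (hg : ∀ k, ‖g k‖ ≤ 1) (hg0 : g 0 = 0) :
    Summable (fun k : ℤ => ‖f (k * t) * g k‖) ∧ ‖∑' k : ℤ, f (k * t) * g k‖ ≤ 4 * C / t := by
  have hC : 0 ≤ C := by
    have := (norm_nonneg _).trans (hf 0)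
    simpa using this
  have hb : ∀ k : ℤ, ‖f (k * t) * g k‖ ≤ C / t * nzf t⁻¹ k := by
    intro k
    rw [nzf]
    split_ifs with h
    · simp [h, hg0]
    · rw [norm_mul]
      have h1 := hf (k * t)
      have h2 : C / (1 + (k * t) ^ 2) = C / t * (t⁻¹ / (t⁻¹ ^ 2 + (k : ℝ) ^ 2)) := by
        field_simp
      rw [← h2]
      calc _ ≤ ‖f (k * t)‖ * 1 := by gcongr; exact hg k
        _ ≤ _ := by rw [mul_one]; exact h1
  obtain ⟨s1, s2⟩ := aux_int_sum (inv_pos.2 ht)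
  have s3 := s1.mul_left (C / t)
  have s4 := Summable.of_nonneg_of_le (fun k => norm_nonneg _) hb s3
  refine ⟨s4, (norm_tsum_le_tsum_norm s4).trans ((s4.tsum_le_tsum hb s3).trans ?_)⟩
  rw [tsum_mul_left]
  have : 0 ≤ C / t := by positivity
  calc _ ≤ C / t * 4 := by gcongr
    _ = _ := by ring

lemma schwartz_summable_int (f : SchwartzMap ℝ ℂ) : Summable (fun n : ℤ => f n) :=
  summable_of_isBigO (Real.summable_abs_int_rpow one_lt_two)
    ((f.isBigO_cocompact_rpow (-2)).comp_tendsto Int.tendsto_coe_cofinite)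

open FourierTransform in
lemma aux_poisson (f : SchwartzMap ℝ ℂ) {q : ℕ} [NeZero q] (χ : DirichletCharacter ℂ q)
    (hχ : χ.IsPrimitive) {t : ℝ} (ht : 0 < t) :
    ∑' k : ℤ, f (k * t) * χ (k : ZMod q) =
      ((q * t)⁻¹ : ℝ) * gaussSum χ ZMod.stdAddChar *
        ∑' h : ℤ, (𝓕 f) (h * (q * t)⁻¹) * χ⁻¹ (h : ZMod q) := by
  have hq : (0 : ℝ) < q := by exact_mod_cast Nat.pos_of_ne_zero (NeZero.ne q)
  have hs : 0 < (q : ℝ) * t := by positivity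
  have hsum : Summable (fun k : ℤ => f (k * t) * χ (k : ZMod q)) := by
    have h1 := schwartz_summable_int (dil f t ht.ne')
    refine Summable.of_norm_bounded h1.norm ?_
    intro k
    rw [norm_mul, dil_apply]
    exact mul_le_of_le_one_right (norm_nonneg _) (χ.norm_le_one _)
  have hsum2 := (Int.divModEquiv q).symm.summable_iff.2 hsum
  have e1 : ∑' k : ℤ, f (k * t) * χ (k : ZMod q) =
      ∑ a : Fin q, χ (((a : ℕ) : ℤ) : ZMod q) * ∑' m : ℤ, (dil f (q * t) hs.ne') ((((a : ℕ) : ℝ) / q) + m) := by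
    rw [← (Int.divModEquiv q).symm.tsum_eq, ← (Equiv.prodComm _ _).tsum_eq, Summable.tsum_prod, tsum_fintype]
    · refine Finset.sum_congr rfl fun a _ => ?_
      rw [← tsum_mul_left]
      refine tsum_congr fun m => ?_
      rw [dil_apply]
      have : ((Int.divModEquiv q).symm ((Equiv.prodComm _ _) (a, m))) = m * q + (a : ℕ) := rfl
      rw [this, mul_comm]
      congr 2
      · push_cast; simp
      · push_cast; field_simp; ring
    · exact (Equiv.prodComm _ _).summable_iff.2 hsum2
  have e2 : ∀ a : Fin q, χ (((a : ℕ) : ℤ) : ZMod q) * ∑' m : ℤ, (dil f (q * t) hs.ne') ((((a : ℕ) : ℝ) / q) + m) =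
      ∑' h : ℤ, (𝓕 (dil f (q * t) hs.ne')) h * (χ (((a : ℕ) : ℤ) : ZMod q) * (ZMod.stdAddChar ((h : ZMod q) * ((a : ℕ) : ZMod q)))) := by
    intro a
    rw [SchwartzMap.tsum_eq_tsum_fourier, ← tsum_mul_left]
    refine tsum_congr fun h => ?_
    have : fourier h (((((a : ℕ) : ℝ) / q : ℝ)) : UnitAddCircle) = ZMod.stdAddChar ((h : ZMod q) * ((a : ℕ) : ZMod q)) := by
      have h1 := ZMod.stdAddChar_coe (N := q) (h * (a : ℕ))
      push_cast at h1
      rw [h1, fourier_coe_apply]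
      congr 1
      push_cast
      ring
    rw [this]; ring
  rw [e1, Finset.sum_congr rfl fun a _ => e2 a, ← Summable.tsum_finsetSum]
  · rw [← tsum_mul_left]
    refine tsum_congr fun h => ?_
    rw [← Finset.mul_sum]
    have e3 : ∑ a : Fin q, (χ (((a : ℕ) : ℤ) : ZMod q) * (ZMod.stdAddChar ((h : ZMod q) * ((a : ℕ) : ZMod q)))) =
        χ⁻¹ (h : ZMod q) * gaussSum χ ZMod.stdAddChar := by
      rw [← gaussSum_mulShift_of_isPrimitive _ hχ, gaussSum]
      refine Fintype.sum_equiv (ZMod.finEquiv q).toEquiv _ _ fun a => ?_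
      have : (ZMod.finEquiv q).toEquiv a = ((a : ℕ) : ZMod q) := by
        obtain ⟨n, rfl⟩ := Nat.exists_eq_succ_of_ne_zero (NeZero.ne q)
        exact (Fin.cast_val_eq_self a).symm
      rw [AddChar.mulShift_apply, this]
      push_cast
      rfl
    rw [e3, dil_fourier f _ hs]
    simp only [Complex.real_smul, div_eq_mul_inv]
    ring
  · intro a _
    refine Summable.of_norm_bounded (schwartz_summable_int (𝓕 (dil f (q * t) hs.ne'))).norm ?_
    intro h
    rw [norm_mul, norm_mul]
    refine mul_le_of_le_one_right (norm_nonneg _) ?_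
    rw [AddChar.norm_apply, mul_one]
    exact χ.norm_le_one _

open FourierTransform in
lemma aux_charsum (f : SchwartzMap ℝ ℂ) : ∃ C : ℝ, 0 < C ∧ ∀ (q : ℕ) [NeZero q]
    (χ : DirichletCharacter ℂ q), χ.IsPrimitive → q ≠ 1 → ∀ δ : ℝ, 0 < δ → δ ≤ 1 → ∀ t : ℝ, 0 < t →
    (Summable fun k : ℤ => f (k * t) * χ (k : ZMod q)) ∧
    ‖∑' k : ℤ, f (k * t) * χ (k : ZMod q)‖ ≤ C * Real.sqrt q * t ^ (-δ) := by
  obtain ⟨C1, h1, H1⟩ := aux_decay f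
  obtain ⟨C2, h2, H2⟩ := aux_decay (𝓕 f)
  refine ⟨4 * C1 + 4 * C2, by positivity, ?_⟩
  intro q _ χ hχ hq1 δ hδ hδ1 t ht
  have hq : (1 : ℝ) ≤ q := by exact_mod_cast Nat.pos_of_ne_zero (NeZero.ne q)
  have hq' : 1 ≤ Real.sqrt q := Real.one_le_sqrt.2 hq
  obtain ⟨a1, a2⟩ := aux_triv H1 ht (g := fun k : ℤ => χ (k : ZMod q)) (fun k => χ.norm_le_one _)
    (by simpa using χ.map_zero' hq1)
  refine ⟨a1.of_norm, ?_⟩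
  rcases le_total t 1 with h | h
  · have ht1 : 1 ≤ t ^ (-δ) := Real.one_le_rpow_of_pos_of_le_one_of_nonpos ht h (by linarith)
    have hs : 0 < ((q : ℝ) * t)⁻¹ := by positivity
    obtain ⟨b1, b2⟩ := aux_triv H2 hs (g := fun k : ℤ => χ⁻¹ (k : ZMod q)) (fun k => (χ⁻¹).norm_le_one _)
      (by simpa using (χ⁻¹).map_zero' hq1)
    rw [aux_poisson f χ hχ ht, norm_mul, norm_mul, aux_gauss χ hχ, Complex.norm_real, Real.norm_eq_abs,
      abs_of_pos hs]
    calc _ ≤ ((q : ℝ) * t)⁻¹ * √q * (4 * C2 / ((q : ℝ) * t)⁻¹) := by gcongr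
      _ = (4 * C2) * √q * 1 := by field_simp
      _ ≤ (4 * C1 + 4 * C2) * √q * t ^ (-δ) := by gcongr; linarith
  · refine a2.trans ?_
    have : t⁻¹ ≤ t ^ (-δ) := by
      rw [← Real.rpow_neg_one]
      exact Real.rpow_le_rpow_of_exponent_le h (by linarith)
    rw [div_eq_mul_inv]
    calc _ ≤ 4 * C1 * 1 * t ^ (-δ) := by rw [mul_one]; gcongr
      _ ≤ (4 * C1 + 4 * C2) * √q * t ^ (-δ) := by gcongr; linarith

lemma aux_sieve {q : ℕ} (χ : DirichletCharacter ℂ q) {f : ℝ → ℂ} {B δ : ℝ} (hB : 0 ≤ B) (hδ : 0 < δ)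
    (H : ∀ t : ℝ, 0 < t → (Summable fun k : ℤ => f (k * t) * χ (k : ZMod q)) ∧
      ‖∑' k : ℤ, f (k * t) * χ (k : ZMod q)‖ ≤ B * t ^ (-δ)) (P : Finset ℕ) (hP : ∀ p ∈ P, p.Prime) :
    ∀ t : ℝ, 0 < t →
      ‖∑' k : ℤ, (if ∀ p ∈ P, ¬ ((p : ℤ) ∣ k) then f (k * t) * χ (k : ZMod q) else 0)‖
        ≤ 2 ^ P.card * (B * t ^ (-δ)) := by
  have hS : ∀ (Q : ℤ → Prop) [DecidablePred Q] (t : ℝ), 0 < t →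
      Summable (fun k : ℤ => if Q k then f (k * t) * χ (k : ZMod q) else 0) := by
    intro Q _ t ht
    refine Summable.of_norm_bounded (H t ht).1.norm fun k => ?_
    split_ifs
    · exact le_rfl
    · rw [norm_zero]; exact norm_nonneg _
  induction P using Finset.induction_on with
  | empty => intro t ht; simpa using (H t ht).2
  | insert r P hr ih =>
    intro t ht
    have hrp : r.Prime := hP r (by simp)
    have hr0 : (0 : ℝ) < r := by exact_mod_cast hrp.pos
    have hr1 : (1 : ℝ) ≤ r := by exact_mod_cast hrp.one_lt.le
    have ih' := ih (fun p hp => hP p (by simp [hp]))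
    have e1 : ∀ k : ℤ, (if ∀ p ∈ insert r P, ¬ ((p : ℤ) ∣ k) then f (k * t) * χ (k : ZMod q) else 0) =
        (if ∀ p ∈ P, ¬ ((p : ℤ) ∣ k) then f (k * t) * χ (k : ZMod q) else 0) -
        (if (r : ℤ) ∣ k ∧ ∀ p ∈ P, ¬ ((p : ℤ) ∣ k) then f (k * t) * χ (k : ZMod q) else 0) := by
      intro k
      simp only [Finset.forall_mem_insert]
      by_cases h1 : (r : ℤ) ∣ k <;> by_cases h2 : ∀ p ∈ P, ¬ ((p : ℤ) ∣ k) <;> simp [h1, h2]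
    have inj : Function.Injective (fun j : ℤ => (r : ℤ) * j) :=
      mul_right_injective₀ (by exact_mod_cast hrp.ne_zero)
    have e2 : ∑' k : ℤ, (if (r : ℤ) ∣ k ∧ ∀ p ∈ P, ¬ ((p : ℤ) ∣ k) then f (k * t) * χ (k : ZMod q) else 0) =
        χ (r : ZMod q) * ∑' k : ℤ, (if ∀ p ∈ P, ¬ ((p : ℤ) ∣ k) then f (k * (r * t)) * χ (k : ZMod q) else 0) := by
      rw [← inj.tsum_eq, ← tsum_mul_left]
      · refine tsum_congr fun k => ?_
        have : (∀ p ∈ P, ¬ ((p : ℤ) ∣ r * k)) ↔ (∀ p ∈ P, ¬ ((p : ℤ) ∣ k)) := by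
          refine forall₂_congr fun p hp => not_congr ⟨fun h => ?_, fun h => h.mul_left _⟩
          have hpp := hP p (by simp [hp])
          refine (Int.isCoprime_iff_gcd_eq_one.2 ?_ : IsCoprime (p : ℤ) r).dvd_of_dvd_mul_left h
          rw [Int.gcd_natCast_natCast]
          exact (Nat.coprime_primes hpp hrp).2 (fun h => hr (h ▸ hp))
        simp only [dvd_mul_right, true_and, this]
        split_ifs
        · push_cast
          rw [map_mul]
          have : (r : ℝ) * k * t = k * (r * t) := by ring
          rw [this]; ring
        · simp
      · intro k hk
        rw [Function.mem_support] at hk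
        by_contra h
        apply hk
        rw [if_neg]
        rintro ⟨⟨j, rfl⟩, _⟩
        exact h ⟨j, rfl⟩
    simp_rw [e1]
    rw [(hS _ t ht).tsum_sub (hS _ t ht), e2, Finset.card_insert_of_notMem hr]
    refine (norm_sub_le _ _).trans ?_
    rw [norm_mul]
    have i1 := ih' t ht
    have i2 := ih' (r * t) (by positivity)
    have i3 : (r * t) ^ (-δ) ≤ t ^ (-δ) :=
      Real.rpow_le_rpow_of_nonpos ht (by nlinarith) (by linarith)
    have i4 : (2 : ℝ) ^ P.card * (B * (r * t) ^ (-δ)) ≤ 2 ^ P.card * (B * t ^ (-δ)) := by gcongr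
    have i5 := mul_le_of_le_one_left (norm_nonneg (∑' k : ℤ, (if ∀ p ∈ P, ¬ ((p : ℤ) ∣ k) then f (k * (r * t)) * χ (k : ZMod q) else 0))) (χ.norm_le_one (r : ZMod q))
    rw [pow_succ]
    linarith

noncomputable def jchar (n : ℕ) [NeZero n] : DirichletCharacter ℂ n where
  toFun a := (jacobiSym (a.val) n : ℂ)
  map_one' := by
    have : jacobiSym ((1 : ZMod n).val) n = 1 := by
      rw [ZMod.val_one_eq_one_mod]
      push_cast
      rw [← jacobiSym.mod_left, jacobiSym.one_left]
    rw [this]; simp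
  map_mul' a b := by
    have : jacobiSym ((a * b).val) n = jacobiSym a.val n * jacobiSym b.val n := by
      rw [ZMod.val_mul]
      push_cast
      rw [← jacobiSym.mod_left, jacobiSym.mul_left]
    rw [this]; simp
  map_nonunit' a ha := by
    have : jacobiSym a.val n = 0 := by
      rw [jacobiSym.eq_zero_iff_not_coprime]
      intro h
      apply ha
      rw [← ZMod.natCast_zmod_val a, ZMod.isUnit_iff_coprime]
      exact h
    rw [this]; simp

lemma jchar_int (n : ℕ) [NeZero n] (k : ℤ) : jchar n (k : ZMod n) = (jacobiSym k n : ℂ) := by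
  change (jacobiSym ((k : ZMod n).val) n : ℂ) = _
  rw [ZMod.val_intCast, ← jacobiSym.mod_left]

lemma exists_odd_val {n : ℕ} (hn : n ≠ 0) (h : ¬ IsSquare n) :
    ∃ p, p.Prime ∧ Odd (n.factorization p) := by
  by_contra hc
  push Not at hc
  apply h
  refine ⟨n.factorization.prod fun p e => p ^ (e / 2), ?_⟩
  conv_lhs => rw [← Nat.prod_factorization_pow_eq_self hn]
  rw [Finsupp.prod, Finsupp.prod, ← Finset.prod_mul_distrib]
  refine Finset.prod_congr rfl fun p hp => ?_
  rw [← pow_add]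
  congr 1
  have := hc p (Nat.prime_of_mem_primeFactors (by simpa using hp))
  rw [Nat.not_odd_iff_even, Nat.even_iff] at this
  omega

lemma jchar_ne_one (n : ℕ) [NeZero n] (hodd : Odd n) (h : ¬ IsSquare n) : jchar n ≠ 1 := by
  have hn := NeZero.ne n
  obtain ⟨p, hp, hv⟩ := exists_odd_val hn h
  have := Fact.mk hp
  have hpn : p ∣ n := by
    by_contra hc
    rw [Nat.factorization_eq_zero_of_not_dvd hc] at hv
    simp at hv
  have hp2 : p ≠ 2 := by
    rintro rfl
    have := Nat.odd_iff.1 hodd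
    omega
  obtain ⟨m, hm, hcop⟩ : ∃ m, n = p ^ n.factorization p * m ∧ Nat.Coprime p m :=
    ⟨_, (Nat.ordProj_mul_ordCompl_eq_self n p).symm, Nat.coprime_ordCompl hp hn⟩
  have hm0 : m ≠ 0 := by rintro rfl; exact hn (by simpa using hm)
  obtain ⟨r, hr⟩ := FiniteField.exists_nonsquare (F := ZMod p) (by rwa [ZMod.ringChar_zmod_n])
  have hr0 : r ≠ 0 := by rintro rfl; exact hr ⟨0, by simp⟩
  obtain ⟨k, hk1, hk2⟩ := Nat.chineseRemainder hcop r.val 1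
  have j1 : jacobiSym k p = -1 := by
    apply ZMod.nonsquare_iff_jacobiSym_eq_neg_one.2
    have : ((k : ℤ) : ZMod p) = r := by
      have := (ZMod.natCast_eq_natCast_iff _ _ _).2 hk1
      push_cast
      rw [this, ZMod.natCast_zmod_val]
    rwa [this]
  have j2 : jacobiSym k m = 1 := by
    rw [← jacobiSym.one_left m]
    apply jacobiSym.mod_left'
    exact_mod_cast hk2
  have j3 : jacobiSym k n = -1 := by
    conv_lhs => rw [hm]
    rw [jacobiSym.mul_right' _ (pow_ne_zero _ hp.ne_zero) hm0, jacobiSym.pow_right, j1, j2, hv.neg_one_pow, mul_one]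
  intro hc
  have := jchar_int n k
  rw [j3, hc] at this
  by_cases hu : IsUnit (((k : ℤ)) : ZMod n)
  · rw [MulChar.one_apply hu] at this; norm_num at this
  · rw [MulChar.map_nonunit _ hu] at this; norm_num at this

lemma omega_bound {A δ : ℝ} (hA : 1 ≤ A) (hδ : 0 < δ) :
    ∃ C : ℝ, 0 < C ∧ ∀ m : ℕ, m ≠ 0 → A ^ m.primeFactors.card ≤ C * (m : ℝ) ^ δ := by
  obtain ⟨P0, hP0⟩ := Filter.eventually_atTop.1
    (((tendsto_rpow_atTop hδ).comp tendsto_natCast_atTop_atTop).eventually_ge_atTop A)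
  refine ⟨A ^ P0, by positivity, fun m hm => ?_⟩
  have h1 : ∀ p ∈ m.primeFactors, A ≤ (if p < P0 then A else 1) * (p : ℝ) ^ δ := by
    intro p hp
    have hp1 : (1 : ℝ) ≤ p := by exact_mod_cast (Nat.prime_of_mem_primeFactors hp).one_lt.le
    split_ifs with h
    · exact le_mul_of_one_le_right (by linarith) (Real.one_le_rpow hp1 hδ.le)
    · rw [one_mul]; exact hP0 p (by omega)
  have h2 := Finset.prod_le_prod (s := m.primeFactors) (fun _ _ => by linarith) h1
  rw [Finset.prod_const, Finset.prod_mul_distrib] at h2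
  refine h2.trans ?_
  have h3 : ∏ p ∈ m.primeFactors, (if p < P0 then A else 1) ≤ A ^ P0 := by
    rw [← Finset.prod_filter, Finset.prod_const]
    refine pow_le_pow_right₀ hA ?_
    have : m.primeFactors.filter (· < P0) ⊆ Finset.range P0 := by
      intro p hp; simp at hp ⊢; exact hp.2
    simpa using Finset.card_le_card this
  have h4 : ∏ p ∈ m.primeFactors, (p : ℝ) ^ δ ≤ (m : ℝ) ^ δ := by
    rw [Real.finsetProd_rpow _ _ (fun _ _ => by positivity)]
    refine Real.rpow_le_rpow (by positivity) ?_ hδ.le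
    have := Nat.le_of_dvd (Nat.pos_of_ne_zero hm) (Nat.prod_primeFactors_dvd m)
    rw [← Nat.cast_prod]
    exact Nat.cast_le.2 this
  gcongr

lemma euler_bound {δ : ℝ} (hδ : 0 < δ) (s : Finset ℕ) (hs : ∀ p ∈ s, p.Prime) :
    Summable (fun g : Nat.factoredNumbers s => ((g : ℕ) : ℝ) ^ (-δ)) ∧
    ∑' g : Nat.factoredNumbers s, ((g : ℕ) : ℝ) ^ (-δ) ≤ ((1 - (2 : ℝ) ^ (-δ))⁻¹) ^ s.card := by
  let f : ℕ →* ℝ :=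
    { toFun := fun g => (g : ℝ) ^ (-δ)
      map_one' := by simp
      map_mul' := fun a b => by push_cast; rw [Real.mul_rpow (by positivity) (by positivity)] }
  have hf : ∀ g : ℕ, f g = (g : ℝ) ^ (-δ) := fun g => rfl
  have h2 : (2 : ℝ) ^ (-δ) < 1 := Real.rpow_lt_one_of_one_lt_of_neg (by norm_num) (by linarith)
  have hle : ∀ {p : ℕ}, p.Prime → (p : ℝ) ^ (-δ) ≤ (2 : ℝ) ^ (-δ) := by
    intro p hp
    exact Real.rpow_le_rpow_of_nonpos (by norm_num) (by exact_mod_cast hp.two_le) (by linarith)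
  obtain ⟨h3, h4⟩ := EulerProduct.summable_and_hasSum_factoredNumbers_prod_filter_prime_geometric
    (f := f) (fun {p} hp => by
      rw [hf, Real.norm_of_nonneg (by positivity)]; exact (hle hp).trans_lt h2) s
  refine ⟨h4.summable, ?_⟩
  have := h4.tsum_eq
  simp only [hf] at this
  rw [this, Finset.filter_true_of_mem hs, ← Finset.prod_const]
  refine Finset.prod_le_prod (fun p hp => ?_) (fun p hp => ?_)
  · have := hle (hs p hp)
    exact inv_nonneg.2 (by linarith)
  · have := hle (hs p hp)
    exact inv_anti₀ (by linarith) (by linarith)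

lemma coprime_iff_primes {M : ℕ} (hM : M ≠ 0) (k : ℤ) :
    (∀ p ∈ M.primeFactors, ¬ ((p : ℤ) ∣ k)) ↔ Nat.Coprime k.natAbs M := by
  constructor
  · intro h
    refine Nat.Coprime.symm (Nat.coprime_of_dvd fun p hp h1 h2 => ?_)
    exact h p (Nat.mem_primeFactors.2 ⟨hp, h1, hM⟩) (Int.natCast_dvd.2 h2)
  · intro h p hp hd
    have hpp := Nat.prime_of_mem_primeFactors hp
    have h1 := Nat.dvd_of_mem_primeFactors hp
    have h2 := Int.natCast_dvd.1 hd
    exact Nat.Prime.not_coprime_iff_dvd.2 ⟨p, hpp, h2, h1⟩ h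

lemma mem_fact {n g : ℕ} (hn : n ≠ 0) (hg : g ∈ Nat.factoredNumbers n.primeFactors) {p : ℕ}
    (hp : p.Prime) (h : p ∣ g) : p ∣ n :=
  Nat.dvd_of_mem_primeFactors (Nat.mem_factoredNumbers'.1 hg p hp h)

lemma fact_coprime {n g m : ℕ} (hn : n ≠ 0) (hg : g ∈ Nat.factoredNumbers n.primeFactors)
    (hm : Nat.Coprime m n) : Nat.Coprime g m := by
  refine Nat.coprime_of_dvd fun p hp h1 h2 => ?_
  exact Nat.Prime.not_coprime_iff_dvd.2 ⟨p, hp, h2, mem_fact hn hg hp h1⟩ hm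

lemma exists_split {n : ℕ} (hn : n ≠ 0) (m : ℕ) (hm : 0 < m) :
    ∃ g ∈ Nat.factoredNumbers n.primeFactors, ∃ m', 0 < m' ∧ Nat.Coprime m' n ∧ m = g * m' := by
  induction m using Nat.strong_induction_on with
  | _ m ih =>
    by_cases hc : Nat.Coprime m n
    · exact ⟨1, Nat.mem_factoredNumbers'.2 (fun p hp h => absurd (Nat.dvd_one.1 h) hp.ne_one), m, hm, hc, by simp⟩
    · obtain ⟨p, hp, h1, h2⟩ := Nat.Prime.not_coprime_iff_dvd.1 hc
      obtain ⟨a, rfl⟩ := h1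
      have ha : 0 < a := Nat.pos_of_mul_pos_left hm
      obtain ⟨g, hg, m', h3, h4, h5⟩ := ih a (by nlinarith [hp.two_le]) ha
      refine ⟨p * g, ?_, m', h3, h4, by rw [h5]; ring⟩
      refine Nat.mul_mem_factoredNumbers ?_ hg
      rw [Nat.mem_factoredNumbers']
      intro r hr hd
      rw [(Nat.prime_dvd_prime_iff_eq hr hp).1 hd]
      exact Nat.mem_primeFactors.2 ⟨hp, h2, hn⟩

lemma split_unique {n : ℕ} (hn : n ≠ 0) {g g' m m' : ℕ}
    (hg : g ∈ Nat.factoredNumbers n.primeFactors) (hg' : g' ∈ Nat.factoredNumbers n.primeFactors)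
    (hm : Nat.Coprime m n) (hm' : Nat.Coprime m' n) (h : g * m = g' * m') : g = g' ∧ m = m' := by
  have e : g = g' := by
    apply Nat.dvd_antisymm
    · exact (fact_coprime hn hg hm').dvd_of_dvd_mul_right (h ▸ Dvd.intro _ rfl)
    · exact (fact_coprime hn hg' hm).dvd_of_dvd_mul_right (h ▸ Dvd.intro _ rfl)
  subst e
  exact ⟨rfl, Nat.eq_of_mul_eq_mul_left (Nat.pos_of_ne_zero (Nat.ne_zero_of_mem_factoredNumbers hg)) h⟩

lemma sqf_unique {d d' : ℤ} (hd : Squarefree d) (hd' : Squarefree d') {m m' : ℕ} (hm : 0 < m) (hm' : 0 < m')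
    (h : d * (m : ℤ) ^ 2 = d' * (m' : ℤ) ^ 2) : d = d' ∧ m = m' := by
  have key : ∀ {d d' : ℤ} {m m' : ℕ}, Squarefree d' → 0 < m → 0 < m' →
      d * (m : ℤ) ^ 2 = d' * (m' : ℤ) ^ 2 → m ∣ m' := by
    intro d d' m m' hd' hm hm' h
    obtain ⟨k, a, b, hk, hab, rfl, rfl⟩ := Nat.exists_coprime' (Nat.gcd_pos_of_pos_left m' hm)
    have hk0 : (k : ℤ) ≠ 0 := by exact_mod_cast hk.ne'
    have h1 : d * (a : ℤ) ^ 2 = d' * (b : ℤ) ^ 2 := by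
      push_cast at h
      have : (k : ℤ) ^ 2 * (d * (a : ℤ) ^ 2) = (k : ℤ) ^ 2 * (d' * (b : ℤ) ^ 2) := by linarith
      exact mul_left_cancel₀ (pow_ne_zero 2 hk0) this
    have hcop : IsCoprime ((a : ℤ) ^ 2) ((b : ℤ) ^ 2) := (Nat.isCoprime_iff_coprime.2 hab).pow
    have h2 : (a : ℤ) ^ 2 ∣ d' := hcop.dvd_of_dvd_mul_right (h1 ▸ Dvd.intro_left _ rfl)
    have h3 := hd' a (by rwa [pow_two] at h2)
    have h4 : a = 1 := by simpa [Int.isUnit_iff_natAbs_eq] using h3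
    rw [h4, one_mul]
    exact Dvd.intro_left _ rfl
  have e : m = m' := Nat.dvd_antisymm (key hd' hm hm' h) (key hd hm' hm h.symm)
  subst e
  have : (m : ℤ) ^ 2 ≠ 0 := pow_ne_zero 2 (by exact_mod_cast hm.ne')
  exact ⟨mul_right_cancel₀ this h, rfl⟩

lemma sqf_exists (k : ℤ) (hk : k ≠ 0) : ∃ d : ℤ, Squarefree d ∧ ∃ m : ℕ, 0 < m ∧ k = d * (m : ℤ) ^ 2 := by
  obtain ⟨a, b, ha, hb, h1, h2⟩ := Nat.sq_mul_squarefree_of_pos (Int.natAbs_pos.2 hk)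
  refine ⟨k.sign * a, ?_, b, hb, ?_⟩
  · rw [← Int.squarefree_natAbs, Int.natAbs_mul, Int.natAbs_sign_of_ne_zero hk]
    simpa using h2
  · conv_lhs => rw [← Int.sign_mul_natAbs k, ← h1]
    push_cast; ring

noncomputable def Ff (w : ℝ → ℝ) (N : ℕ) (X : ℝ) (n : ℕ) (x : ℤ × ℕ) : ℝ :=
  if (Squarefree x.1 ∧ Int.gcd x.1 N = 1) ∧ (0 < x.2 ∧ Nat.Coprime x.2 N) then
    w ((x.2 : ℝ) ^ 2 * ((x.1 : ℝ) / X)) * (jacobiSym x.1 n : ℝ) else 0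

noncomputable def Gg (w : ℝ → ℝ) (N : ℕ) (X : ℝ) (n : ℕ)
    (x : Nat.factoredNumbers n.primeFactors × ℤ) : ℝ :=
  if Nat.Coprime x.1 N ∧ Nat.Coprime x.2.natAbs N then
    w (((x.1 : ℕ) : ℝ) ^ 2 * ((x.2 : ℝ) / X)) * (jacobiSym x.2 n : ℝ) else 0

abbrev Tri (n : ℕ) : Type :=
  {x : ℤ × Nat.factoredNumbers n.primeFactors × ℕ // Squarefree x.1 ∧ 0 < x.2.2 ∧ Nat.Coprime x.2.2 n}

def phi1 (n : ℕ) (x : Tri n) : ℤ × ℕ := (x.1.1, x.1.2.1 * x.1.2.2)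
def phi2 (n : ℕ) (x : Tri n) : Nat.factoredNumbers n.primeFactors × ℤ :=
  (x.1.2.1, x.1.1 * (x.1.2.2 : ℤ) ^ 2)

lemma phi1_inj {n : ℕ} (hn : n ≠ 0) : Function.Injective (phi1 n) := by
  rintro ⟨⟨d, g, m⟩, h1, h2, h3⟩ ⟨⟨d', g', m'⟩, h1', h2', h3'⟩ h
  simp only [phi1, Prod.mk.injEq] at h
  obtain ⟨rfl, h⟩ := h
  obtain ⟨e1, e2⟩ := split_unique hn g.2 g'.2 h3 h3' h
  apply Subtype.ext
  simp only [Prod.mk.injEq, true_and]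
  exact ⟨Subtype.ext e1, e2⟩

lemma phi2_inj {n : ℕ} : Function.Injective (phi2 n) := by
  rintro ⟨⟨d, g, m⟩, h1, h2, h3⟩ ⟨⟨d', g', m'⟩, h1', h2', h3'⟩ h
  simp only [phi2, Prod.mk.injEq] at h
  obtain ⟨rfl, h⟩ := h
  obtain ⟨e1, e2⟩ := sqf_unique h1 h1' h2 h2' h
  apply Subtype.ext
  simp only [Prod.mk.injEq, true_and]
  exact ⟨e1, e2⟩

lemma supp1 (w : ℝ → ℝ) (N : ℕ) (X : ℝ) {n : ℕ} (hn : n ≠ 0) :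
    Function.support (Ff w N X n) ⊆ Set.range (phi1 n) := by
  rintro ⟨d, m⟩ h
  rw [Function.mem_support] at h
  have : (Squarefree d ∧ Int.gcd d N = 1) ∧ (0 < m ∧ Nat.Coprime m N) := by
    by_contra hc
    exact h (if_neg hc)
  obtain ⟨g, hg, m', h1, h2, h3⟩ := exists_split hn m this.2.1
  exact ⟨⟨(d, ⟨g, hg⟩, m'), this.1.1, h1, h2⟩, by simp [phi1, h3]⟩

lemma supp2 (w : ℝ → ℝ) (N : ℕ) (X : ℝ) {n : ℕ} (hn : n ≠ 0) (hn1 : n ≠ 1) :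
    Function.support (Gg w N X n) ⊆ Set.range (phi2 n) := by
  rintro ⟨g, k⟩ h
  rw [Function.mem_support] at h
  have hJ : jacobiSym k n ≠ 0 := by
    intro hc
    apply h
    simp [Gg, hc]
  have hk : k ≠ 0 := by
    rintro rfl
    exact hJ (jacobiSym.zero_left (by omega))
  have hc : Int.gcd k n = 1 := by
    by_contra hc
    exact hJ (jacobiSym.eq_zero_iff.2 ⟨hn, hc⟩)
  obtain ⟨d, hd, m, hm, rfl⟩ := sqf_exists k hk
  refine ⟨⟨(d, g, m), hd, hm, ?_⟩, rfl⟩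
  have : Nat.Coprime (d * (m : ℤ) ^ 2).natAbs n := hc
  refine Nat.Coprime.coprime_dvd_left ?_ this
  rw [Int.natAbs_mul, Int.natAbs_pow, Int.natAbs_natCast]
  exact (dvd_pow_self m two_ne_zero).mul_left _

lemma Ff_eq_Gg (w : ℝ → ℝ) (N : ℕ) (X : ℝ) {n : ℕ} (x : Tri n) :
    Ff w N X n (phi1 n x) = Gg w N X n (phi2 n x) := by
  obtain ⟨⟨d, g, m⟩, h1, h2, h3⟩ := x
  simp only at h1 h2 h3
  have hg : 0 < (g : ℕ) := Nat.pos_of_ne_zero (Nat.ne_zero_of_mem_factoredNumbers g.2)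
  have hJ : jacobiSym (d * (m : ℤ) ^ 2) n = jacobiSym d n := by
    rw [jacobiSym.mul_left, jacobiSym.sq_one', mul_one]
    exact h3
  have hiff : ((Squarefree d ∧ Int.gcd d N = 1) ∧ (0 < (g : ℕ) * m ∧ Nat.Coprime (g * m) N)) ↔
      (Nat.Coprime g N ∧ Nat.Coprime (d * (m : ℤ) ^ 2).natAbs N) := by
    rw [Int.natAbs_mul, Int.natAbs_pow, Int.natAbs_natCast, Nat.coprime_mul_iff_left, Nat.coprime_mul_iff_left,
      Nat.coprime_pow_left_iff (by norm_num)]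
    have : Int.gcd d N = 1 ↔ Nat.Coprime d.natAbs N := Iff.rfl
    have h4 : 0 < (g : ℕ) * m := by positivity
    rw [this]
    tauto
  have hw : ((((g : ℕ) * m : ℕ) : ℝ)) ^ 2 * ((d : ℝ) / X) =
      ((g : ℕ) : ℝ) ^ 2 * (((d * (m : ℤ) ^ 2 : ℤ) : ℝ) / X) := by
    push_cast
    ring
  by_cases hc : Nat.Coprime g N ∧ Nat.Coprime (d * (m : ℤ) ^ 2).natAbs N
  · refine (show Ff w N X n (d, (g : ℕ) * m) = _ from if_pos (hiff.2 hc)).trans ?_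
    refine Eq.trans ?_ (show Gg w N X n (g, d * (m : ℤ) ^ 2) = _ from if_pos hc).symm
    simp only []
    rw [hJ, hw]
  · exact (show Ff w N X n (d, (g : ℕ) * m) = 0 from if_neg (fun h => hc (hiff.1 h))).trans
      (show Gg w N X n (g, d * (m : ℤ) ^ 2) = 0 from if_neg hc).symm

lemma Ff_summable {w : ℝ → ℝ} {C : ℝ} (hw : ∀ x : ℝ, |w x| ≤ C / (1 + x ^ 2)) (N : ℕ) {X : ℝ} (hX : 1 ≤ X)
    (n : ℕ) : Summable (Ff w N X n) := by
  have hC : 0 ≤ C := by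
    have := (abs_nonneg _).trans (hw 0)
    simpa using this
  have s1 : Summable (fun d : ℤ => 1 / (d : ℝ) ^ 2) := Real.summable_one_div_int_pow.2 (by norm_num)
  have s2 : Summable (fun d : ℕ => 1 / (d : ℝ) ^ 2) := Real.summable_one_div_nat_pow.2 (by norm_num)
  have s3 := (s1.mul_of_nonneg s2 (fun _ => by positivity) (fun _ => by positivity)).mul_left (C * X ^ 2)
  refine Summable.of_norm_bounded s3 ?_
  rintro ⟨d, m⟩
  simp only [Ff]
  split_ifs with h
  · have hd : (d : ℝ) ≠ 0 := by exact_mod_cast h.1.1.ne_zero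
    have hm : (1 : ℝ) ≤ m := by exact_mod_cast h.2.1
    have hJ : |(jacobiSym d n : ℝ)| ≤ 1 := by
      rcases jacobiSym.trichotomy d n with h | h | h <;> simp [h]
    rw [Real.norm_eq_abs, abs_mul]
    have hd2 : 0 < (d : ℝ) ^ 2 := by positivity
    calc _ ≤ C / (1 + ((m : ℝ) ^ 2 * (d / X)) ^ 2) * 1 := by
          gcongr
          exact hw _
      _ ≤ C / ((m : ℝ) ^ 2 * d ^ 2 / X ^ 2) := by
          rw [mul_one]
          gcongr
          have : ((m : ℝ) ^ 2 * (d / X)) ^ 2 = (m : ℝ) ^ 2 * ((m : ℝ) ^ 2 * d ^ 2 / X ^ 2) := by ring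
          rw [this]
          have h1 : 1 ≤ (m : ℝ) ^ 2 := one_le_pow₀ hm
          have h2 : 0 ≤ (m : ℝ) ^ 2 * d ^ 2 / X ^ 2 := by positivity
          nlinarith
      _ = _ := by field_simp
  · rw [norm_zero]; positivity

lemma lhs_eq {w : ℝ → ℝ} {C : ℝ} (hw : ∀ x : ℝ, |w x| ≤ C / (1 + x ^ 2)) (N : ℕ) {X : ℝ} (hX : 1 ≤ X)
    {n : ℕ} (hn : n ≠ 0) (hn1 : n ≠ 1) :
    (Summable (Gg w N X n)) ∧ (∑' d : ℤ, if Squarefree d ∧ Int.gcd d N = 1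
            then wtilde w N ((d : ℝ) / X) * (jacobiSym d n : ℝ) else 0) =
    ∑' g : Nat.factoredNumbers n.primeFactors, ∑' k : ℤ, Gg w N X n (g, k) := by
  have hF := Ff_summable hw N hX n
  have hG : Summable (Gg w N X n) := by
    rw [← phi2_inj.summable_iff]
    · have : Gg w N X n ∘ phi2 n = Ff w N X n ∘ phi1 n := by
        funext x; exact (Ff_eq_Gg w N X x).symm
      rw [this]
      exact hF.comp_injective (phi1_inj hn)
    · intro x hx
      by_contra hc
      exact hx (supp2 w N X hn hn1 hc)
  refine ⟨hG, ?_⟩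
  have e1 : ∑' x, Ff w N X n x = ∑' x, Gg w N X n x := by
    rw [← (phi1_inj hn).tsum_eq (supp1 w N X hn), ← phi2_inj.tsum_eq (supp2 w N X hn hn1)]
    exact tsum_congr fun x => Ff_eq_Gg w N X x
  rw [← hG.tsum_prod, ← e1, hF.tsum_prod]
  refine tsum_congr fun d => ?_
  split_ifs with h
  · rw [wtilde, ← tsum_mul_right]
    refine tsum_congr fun m => ?_
    simp only [Ff, h, true_and, and_self]
    split_ifs <;> simp
  · simp [Ff, h]

lemma inner_bound (w : SchwartzMap ℝ ℝ) : ∃ C : ℝ, 0 < C ∧ ∀ δ : ℝ, 0 < δ → δ ≤ 1 → ∀ N : ℕ, 0 < N →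
    ∀ X : ℝ, 1 ≤ X → ∀ n : ℕ, Odd n → 0 < n → ¬ IsSquare n →
    ∀ g : Nat.factoredNumbers n.primeFactors,
      |∑' k : ℤ, Gg w N X n (g, k)| ≤
        2 ^ (n * N).primeFactors.card * (C * Real.sqrt n * X ^ δ) * ((g : ℕ) : ℝ) ^ (-(2 * δ)) := by
  let f : SchwartzMap ℝ ℂ := w.postcompCLM Complex.ofRealCLM
  have hf : ∀ x, f x = (w x : ℂ) := fun x => rfl
  obtain ⟨C, hC, H⟩ := aux_charsum f
  refine ⟨C, hC, ?_⟩
  intro δ hδ hδ1 N hN X hX n hodd hn hsq g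
  have hn0 : n ≠ 0 := hn.ne'
  have : NeZero n := ⟨hn0⟩
  have hX0 : 0 < X := by linarith
  have hg : (0 : ℝ) < (g : ℕ) := by
    exact_mod_cast Nat.pos_of_ne_zero (Nat.ne_zero_of_mem_factoredNumbers g.2)
  by_cases hcop : Nat.Coprime g N
  swap
  · simp only [Gg, hcop, false_and, if_false, tsum_zero, abs_zero]
    positivity
  set χ := (jchar n).primitiveCharacter with hχ
  have hprim : χ.IsPrimitive := (jchar n).primitiveCharacter_isPrimitive
  have hcne : (jchar n).conductor ≠ 1 := fun h =>
    jchar_ne_one n hodd hsq ((jchar n).eq_one_iff_conductor_eq_one.2 h)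
  have : NeZero (jchar n).conductor := ⟨(jchar n).conductor_ne_zero⟩
  have hcle : ((jchar n).conductor : ℝ) ≤ n := by
    exact_mod_cast Nat.le_of_dvd hn (jchar n).conductor_dvd_level
  have ht : 0 < ((g : ℕ) : ℝ) ^ 2 / X := by positivity
  have h1 := aux_sieve χ (f := f) (B := C * Real.sqrt (jchar n).conductor) (δ := δ) (by positivity) hδ
    (fun t ht => H _ χ hprim hcne δ hδ hδ1 t ht) (n * N).primeFactors
    (fun p hp => Nat.prime_of_mem_primeFactors hp) _ ht
  have h2 : ((∑' k : ℤ, Gg w N X n (g, k) : ℝ) : ℂ) =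
      ∑' k : ℤ, (if ∀ p ∈ (n * N).primeFactors, ¬ ((p : ℤ) ∣ k) then
        f (k * (((g : ℕ) : ℝ) ^ 2 / X)) * χ (k : ZMod (jchar n).conductor) else 0) := by
    rw [Complex.ofReal_tsum]
    refine tsum_congr fun k => ?_
    have hiff := coprime_iff_primes (mul_ne_zero hn0 hN.ne') k
    rw [Nat.coprime_mul_iff_right] at hiff
    by_cases hk : Nat.Coprime k.natAbs n
    · have hk' : IsCoprime k (n : ℤ) := Int.isCoprime_iff_gcd_eq_one.2 hk
      have e1 := (jchar n).primitiveCharacter_apply_of_isCoprime hk'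
      rw [jchar_int] at e1
      have e2 : k * (((g : ℕ) : ℝ) ^ 2 / X) = ((g : ℕ) : ℝ) ^ 2 * (k / X) := by ring
      by_cases hkN : Nat.Coprime k.natAbs N
      · rw [if_pos (hiff.2 ⟨hk, hkN⟩), hχ, e1, hf, e2]
        have e3 : Gg w N X n (g, k) = w (((g : ℕ) : ℝ) ^ 2 * ((k : ℝ) / X)) * (jacobiSym k n : ℝ) :=
          if_pos ⟨hcop, hkN⟩
        rw [e3]
        push_cast
        rfl
      · rw [if_neg (fun h => hkN (hiff.1 h).2)]
        simp [Gg, hkN]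
    · rw [if_neg (fun h => hk (hiff.1 h).1)]
      have : jacobiSym k n = 0 := jacobiSym.eq_zero_iff.2 ⟨hn0, hk⟩
      simp [Gg, this]
  rw [← h2, Complex.norm_real, Real.norm_eq_abs] at h1
  refine h1.trans ?_
  have h3 : (((g : ℕ) : ℝ) ^ 2 / X) ^ (-δ) = X ^ δ * ((g : ℕ) : ℝ) ^ (-(2 * δ)) := by
    rw [Real.div_rpow (by positivity) hX0.le, ← Real.rpow_natCast, ← Real.rpow_mul hg.le,
      Real.rpow_neg hX0.le, div_inv_eq_mul, mul_comm]
    congr 2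
    push_cast; ring
  rw [h3]
  calc _ ≤ 2 ^ (n * N).primeFactors.card * (C * √n * (X ^ δ * ((g : ℕ) : ℝ) ^ (-(2 * δ)))) := by
        gcongr
    _ = _ := by ring

/-- Weighted character sum estimate for non-square odd `n`:
`∑*_{(d,N)=1} w̃(d/X) (d|n) ≪_{ε,w} n^{1/2+ε} (XN)^ε`. -/
theorem weighted_char_sum_nonsquare (w : SchwartzMap ℝ ℝ)
    (heven : ∀ x : ℝ, w (-x) = w x) :
    ∀ ε : ℝ, 0 < ε → ∃ C : ℝ, 0 < C ∧
      ∀ N : ℕ, 0 < N → ∀ X : ℝ, 1 ≤ X → ∀ n : ℕ, Odd n → 0 < n → ¬ IsSquare n →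
        |∑' d : ℤ, if Squarefree d ∧ Int.gcd d N = 1
            then wtilde (⇑w) N ((d : ℝ) / X) * (jacobiSym d n : ℝ) else 0|
          ≤ C * (n : ℝ) ^ ((1 : ℝ) / 2 + ε) * (X * N) ^ ε := by
  intro ε hε
  obtain ⟨C1, hC1, H1⟩ := inner_bound w
  obtain ⟨C0, hC0, H0⟩ := aux_decay (w.postcompCLM Complex.ofRealCLM)
  have H0' : ∀ x : ℝ, |w x| ≤ C0 / (1 + x ^ 2) := by
    intro x
    have := H0 x
    rwa [SchwartzMap.postcompCLM_apply, Complex.ofRealCLM_apply, Complex.norm_real, Real.norm_eq_abs] at this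
  obtain ⟨δ, hδ, hδ1, hδε⟩ : ∃ δ : ℝ, 0 < δ ∧ δ ≤ 1 ∧ 2 * δ ≤ ε :=
    ⟨min (ε / 2) 1, by positivity, min_le_right _ _, by linarith [min_le_left (ε / 2) 1]⟩
  have h2 : (2 : ℝ) ^ (-(2 * δ)) < 1 := Real.rpow_lt_one_of_one_lt_of_neg (by norm_num) (by linarith)
  have h2' : 0 < (2 : ℝ) ^ (-(2 * δ)) := by positivity
  have hA : 1 ≤ (1 - (2 : ℝ) ^ (-(2 * δ)))⁻¹ := (one_le_inv₀ (by linarith)).2 (by linarith)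
  obtain ⟨C2, hC2, H2⟩ := omega_bound (A := 2) (δ := δ) (by norm_num) hδ
  obtain ⟨C3, hC3, H3⟩ := omega_bound hA hδ
  refine ⟨C2 * C1 * C3, by positivity, ?_⟩
  intro N hN X hX n hodd hn hsq
  have hn1 : n ≠ 1 := by rintro rfl; exact hsq ⟨1, by norm_num⟩
  have hX0 : 0 < X := by linarith
  have hnR : (1 : ℝ) ≤ n := by exact_mod_cast hn
  have hNR : (1 : ℝ) ≤ N := by exact_mod_cast hN
  have hn0' : (0 : ℝ) < n := by linarith
  have hN0' : (0 : ℝ) < N := by linarith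
  obtain ⟨hG, e⟩ := lhs_eq H0' N hX hn.ne' hn1
  obtain ⟨E1, E2⟩ := euler_bound (δ := 2 * δ) (by linarith) n.primeFactors
    (fun p hp => Nat.prime_of_mem_primeFactors hp)
  rw [e]
  set K : ℝ := 2 ^ (n * N).primeFactors.card * (C1 * Real.sqrt n * X ^ δ) with hK
  have hb := H1 δ hδ hδ1 N hN X hX n hodd hn hsq
  have step : |∑' g : Nat.factoredNumbers n.primeFactors, ∑' k : ℤ, Gg w N X n (g, k)| ≤
      K * ∑' g : Nat.factoredNumbers n.primeFactors, ((g : ℕ) : ℝ) ^ (-(2 * δ)) := by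
    rw [← tsum_mul_left, ← Real.norm_eq_abs]
    exact tsum_of_norm_bounded (E1.mul_left K).hasSum hb
  refine step.trans ?_
  have hK2 : K ≤ C2 * ((n : ℝ) * N) ^ δ * (C1 * Real.sqrt n * X ^ δ) := by
    have := H2 (n * N) (mul_ne_zero hn.ne' hN.ne')
    push_cast at this
    rw [hK]
    gcongr
  have hE := E2.trans (H3 n hn.ne')
  calc _ ≤ (C2 * ((n : ℝ) * N) ^ δ * (C1 * Real.sqrt n * X ^ δ)) * (C3 * (n : ℝ) ^ δ) := by
        gcongr
    _ = C2 * C1 * C3 * (n : ℝ) ^ ((1 : ℝ) / 2 + 2 * δ) * (X * N) ^ δ := by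
        rw [Real.mul_rpow hn0'.le hN0'.le, Real.mul_rpow hX0.le hN0'.le, Real.rpow_add hn0',
          two_mul, Real.rpow_add hn0', Real.sqrt_eq_rpow]
        ring
    _ ≤ _ := by
        gcongr
        · nlinarith
        · linarith
end

section
/- Let g : ℝ → ℝ be a Schwartz function. There exists a constant C > 0, depending only on g, such that for every odd prime p and every real Q > 0, |∑_{t ∈ ℤ} (t/p) · g(t/Q)| ≤ C · √p · log p. -/
theorem spv_summable (g : SchwartzMap ℝ ℝ) (Q : ℝ) (hQ : 0 < Q) :
    Summable (fun t : ℤ => g ((t : ℝ) / Q)) := by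
  obtain ⟨K, hK, h⟩ := g.decay 2 0
  have hs : Summable (fun t : ℤ => K * Q ^ 2 * (1 / (t : ℝ) ^ 2)) :=
    (Real.summable_one_div_int_pow.mpr (by norm_num)).mul_left _
  refine Summable.of_norm_bounded_eventually hs ?_
  have : {x : ℤ | ¬ ‖g ((x : ℝ) / Q)‖ ≤ K * Q ^ 2 * (1 / (x : ℝ) ^ 2)} ⊆ {0} := by
    intro t ht
    by_contra h0
    apply ht
    have h0' : (t : ℝ) ≠ 0 := by exact_mod_cast h0
    have h1 := h ((t : ℝ) / Q)
    rw [norm_iteratedFDeriv_zero, Real.norm_eq_abs ((t : ℝ) / Q), sq_abs] at h1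
    have h2 : 0 < (t : ℝ) ^ 2 := by positivity
    rw [mul_one_div, le_div_iff₀ h2]
    rw [div_pow, div_mul_eq_mul_div, div_le_iff₀ (by positivity)] at h1
    linarith
  exact (Set.finite_singleton (0 : ℤ)).subset this

theorem spv_variation (g : SchwartzMap ℝ ℝ) (Q : ℝ) (hQ : 0 < Q) :
    Summable (fun t : ℤ => |g (((t + 1 : ℤ) : ℝ) / Q) - g ((t : ℝ) / Q)|) ∧
    ∑' t : ℤ, |g (((t + 1 : ℤ) : ℝ) / Q) - g ((t : ℝ) / Q)| ≤ ∫ x, |deriv g x| := by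
  have hint : MeasureTheory.Integrable (fun x => deriv g x) := by
    have := (SchwartzMap.derivCLM ℝ ℝ g).integrable (μ := MeasureTheory.volume)
    exact this
  have hint2 : MeasureTheory.Integrable (fun x => |deriv g (x / Q)| * Q⁻¹) :=
    ((hint.comp_div hQ.ne').abs).mul_const _
  have hi : ∫ x, |deriv g (x / Q)| * Q⁻¹ = ∫ x, |deriv g x| := by
    rw [MeasureTheory.integral_mul_const,
      MeasureTheory.Measure.integral_comp_div (fun x => |deriv g x|) Q]
    rw [abs_of_pos hQ, smul_eq_mul]
    field_simp
  have hs := hint2.hasSum_intervalIntegral 0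
  rw [hi] at hs
  have hcont : Continuous (deriv g) := (SchwartzMap.derivCLM ℝ ℝ g).continuous
  have hle : ∀ t : ℤ, |g (((t + 1 : ℤ) : ℝ) / Q) - g ((t : ℝ) / Q)| ≤
      ∫ x in (0 + (t : ℝ))..(0 + (t : ℝ) + 1), |deriv g (x / Q)| * Q⁻¹ := by
    intro t
    have hd : ∀ x : ℝ, HasDerivAt (fun y => g (y / Q)) (deriv g (x / Q) * Q⁻¹) x := by
      intro x
      have h1 : HasDerivAt g (deriv g (x / Q)) (x / Q) :=
        (g.differentiable (x / Q)).hasDerivAt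
      have h2 : HasDerivAt (fun y : ℝ => y / Q) (Q⁻¹) x := by
        simpa using (hasDerivAt_id x).div_const Q
      exact h1.comp x h2
    have hc2 : Continuous fun x => deriv g (x / Q) * Q⁻¹ := by fun_prop
    have := intervalIntegral.integral_eq_sub_of_hasDerivAt (a := 0 + (t : ℝ))
      (b := 0 + (t : ℝ) + 1) (fun x _ => hd x) (hc2.intervalIntegrable _ _)
    have h3 := intervalIntegral.norm_integral_le_integral_norm (a := 0 + (t : ℝ))
      (b := 0 + (t : ℝ) + 1) (μ := MeasureTheory.volume)
      (f := fun x => deriv g (x / Q) * Q⁻¹) (by linarith)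
    rw [this] at h3
    simp only [norm_mul, Real.norm_eq_abs, abs_inv, abs_of_pos hQ] at h3
    simpa using h3
  have hsum := Summable.of_nonneg_of_le (fun t => abs_nonneg _) hle hs.summable
  exact ⟨hsum, hs.tsum_eq ▸ hsum.tsum_le_tsum hle hs.summable⟩

theorem spv_abel (h : ℤ → ℝ) (hh : Summable h)
    (hv : Summable (fun t : ℤ => |h (t + 1) - h t|)) (z : ℂ) (hz : ‖z‖ = 1) :
    ‖z - 1‖ * ‖∑' t : ℤ, z ^ t * (h t : ℂ)‖ ≤ ∑' t : ℤ, |h (t + 1) - h t| := by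
  have hz0 : z ≠ 0 := by rintro rfl; simp at hz
  have hs : Summable (fun t : ℤ => z ^ t * (h t : ℂ)) := by
    refine Summable.of_norm ?_
    simpa [hz] using hh.abs
  have hs' : Summable (fun t : ℤ => z ^ (t + 1) * (h (t + 1) : ℂ)) :=
    (Equiv.addRight (1 : ℤ)).summable_iff.mpr hs
  have e1 : ∑' t : ℤ, z ^ (t + 1) * (h (t + 1) : ℂ) = ∑' t : ℤ, z ^ t * (h t : ℂ) :=
    (Equiv.addRight (1 : ℤ)).tsum_eq (fun t : ℤ => z ^ t * (h t : ℂ))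
  have e2 : (1 - z) * ∑' t : ℤ, z ^ t * (h t : ℂ) =
      ∑' t : ℤ, z ^ (t + 1) * ((h (t + 1) - h t : ℝ) : ℂ) := by
    rw [sub_mul, one_mul, ← tsum_mul_left]
    nth_rewrite 1 [← e1]
    rw [← hs'.tsum_sub (hs.mul_left z)]
    refine tsum_congr fun t => ?_
    rw [zpow_add_one₀ hz0]; push_cast; ring
  rw [← norm_sub_rev, ← norm_mul, e2]
  have : ∀ t : ℤ, ‖z ^ (t + 1) * ((h (t + 1) - h t : ℝ) : ℂ)‖ = |h (t + 1) - h t| := by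
    intro t
    rw [norm_mul, norm_zpow, hz, one_zpow, one_mul, Complex.norm_real, Real.norm_eq_abs]
  refine (norm_tsum_le_tsum_norm ?_).trans ?_
  · simpa only [this] using hv
  · simp only [this, le_refl]

theorem spv_sin (x : ℝ) (h0 : 0 < x) (h1 : x < 1) :
    (2 * Real.sin (Real.pi * x))⁻¹ ≤ (1 / 4) * (x⁻¹ + (1 - x)⁻¹) := by
  have hp := Real.pi_pos
  have hx : 0 < 1 - x := by linarith
  rcases le_total x (1 / 2) with h | h
  · have := Real.mul_le_sin (x := Real.pi * x) (by positivity) (by nlinarith)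
    have e : 2 / Real.pi * (Real.pi * x) = 2 * x := by field_simp
    rw [e] at this
    calc (2 * Real.sin (Real.pi * x))⁻¹ ≤ (2 * (2 * x))⁻¹ := by gcongr
      _ = 1 / 4 * x⁻¹ := by rw [mul_inv, mul_inv]; ring
      _ ≤ _ := by have : 0 < (1 - x)⁻¹ := by positivity
                  linarith
  · have := Real.mul_le_sin (x := Real.pi * (1 - x)) (by positivity) (by nlinarith)
    have e : 2 / Real.pi * (Real.pi * (1 - x)) = 2 * (1 - x) := by field_simp
    have e' : Real.sin (Real.pi * (1 - x)) = Real.sin (Real.pi * x) := by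
      rw [mul_sub, mul_one, Real.sin_pi_sub]
    rw [e, e'] at this
    calc (2 * Real.sin (Real.pi * x))⁻¹ ≤ (2 * (2 * (1 - x)))⁻¹ := by gcongr
      _ = 1 / 4 * (1 - x)⁻¹ := by rw [mul_inv, mul_inv]; ring
      _ ≤ _ := by have : 0 < x⁻¹ := by positivity
                  linarith

theorem spv_norm (p : ℕ) [NeZero p] (a : ℕ) (ha : a < p) :
    ‖ZMod.stdAddChar (a : ZMod p) - 1‖ = 2 * Real.sin (Real.pi * (a / p)) := by
  have h := ZMod.stdAddChar_coe (N := p) (a : ℤ)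
  have hp : (0 : ℝ) < p := by exact_mod_cast Nat.pos_of_ne_zero (NeZero.ne p)
  rw [Int.cast_natCast] at h
  rw [h]
  have e : (2 * Real.pi * Complex.I * ((a : ℤ) : ℂ) / p : ℂ) =
      Complex.I * ((2 * (Real.pi * (a / p)) : ℝ) : ℂ) := by
    push_cast; ring
  rw [e, Complex.norm_exp_I_mul_ofReal_sub_one, mul_div_cancel_left₀ _ (two_ne_zero),
    Real.norm_eq_abs, abs_of_nonneg]
  have : (a : ℝ) / p ≤ 1 := by
    rw [div_le_one hp]; exact_mod_cast ha.le
  have h2 := Real.sin_nonneg_of_nonneg_of_le_pi (x := Real.pi * (a / p))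
    (by positivity) (by nlinarith [Real.pi_pos])
  linarith

theorem spv_sum (p : ℕ) [NeZero p] (hp : 3 ≤ p) :
    ∑ a : ZMod p, ‖ZMod.stdAddChar a - 1‖⁻¹ ≤ p * Real.log p := by
  have hp0 : (0 : ℝ) < p := by positivity
  have e : ∑ a : ZMod p, ‖ZMod.stdAddChar a - 1‖⁻¹ =
      ∑ a ∈ Finset.range p, ‖ZMod.stdAddChar (a : ZMod p) - 1‖⁻¹ := by
    symm
    refine Finset.sum_bij (fun a _ => (a : ZMod p)) (fun _ _ => Finset.mem_univ _) ?_ ?_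
      (fun _ _ => rfl)
    · intro a ha b hb hab
      rw [Finset.mem_range] at ha hb
      have := congrArg ZMod.val hab
      rwa [ZMod.val_natCast_of_lt ha, ZMod.val_natCast_of_lt hb] at this
    · intro b _
      exact ⟨b.val, Finset.mem_range.mpr (ZMod.val_lt b), ZMod.natCast_zmod_val b⟩
  obtain ⟨m, rfl⟩ : ∃ m, p = m + 1 := ⟨p - 1, by omega⟩
  rw [e, Finset.sum_range_succ']
  have hlog : 1 ≤ Real.log ((m + 1 : ℕ) : ℝ) := by
    rw [Real.le_log_iff_exp_le hp0]
    have : (3 : ℝ) ≤ ((m + 1 : ℕ) : ℝ) := by exact_mod_cast hp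
    linarith [Real.exp_one_lt_d9]
  have hH : ∑ k ∈ Finset.range m, ((k : ℝ) + 1)⁻¹ ≤ 1 + Real.log ((m + 1 : ℕ) : ℝ) := by
    have h1 := harmonic_le_one_add_log m
    have h2 : ((harmonic m : ℚ) : ℝ) = ∑ k ∈ Finset.range m, ((k : ℝ) + 1)⁻¹ := by
      simp [harmonic]
    rw [← h2]
    refine h1.trans ?_
    have : 0 < (m : ℝ) := by exact_mod_cast (by omega : 0 < m)
    gcongr
    omega
  have hH' : ∑ k ∈ Finset.range m, ((m : ℝ) - k)⁻¹ = ∑ k ∈ Finset.range m, ((k : ℝ) + 1)⁻¹ := by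
    rw [← Finset.sum_range_reflect]
    refine Finset.sum_congr rfl fun k hk => ?_
    rw [Finset.mem_range] at hk
    rw [Nat.cast_sub (by omega), Nat.cast_sub (by omega)]
    push_cast
    congr 1
    ring
  have hb : ∀ k ∈ Finset.range m, ‖ZMod.stdAddChar ((k + 1 : ℕ) : ZMod (m + 1)) - 1‖⁻¹ ≤
      ((m + 1 : ℕ) : ℝ) / 4 * (((k : ℝ) + 1)⁻¹ + ((m : ℝ) - k)⁻¹) := by
    intro k hk
    rw [Finset.mem_range] at hk
    rw [spv_norm (m + 1) (k + 1) (by omega)]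
    have hk' : (k : ℝ) < m := by exact_mod_cast hk
    refine (spv_sin _ (by positivity) ?_).trans (le_of_eq ?_)
    · rw [div_lt_one hp0]; push_cast; linarith
    · have h1 : (m : ℝ) - k ≠ 0 := by linarith
      have h2 : (1 : ℝ) - ((k + 1 : ℕ) : ℝ) / ((m + 1 : ℕ) : ℝ) =
        ((m : ℝ) - k) / ((m + 1 : ℕ) : ℝ) := by
        rw [eq_div_iff hp0.ne', sub_mul, div_mul_cancel₀ _ hp0.ne']; push_cast; ring
      rw [h2, inv_div, inv_div]
      push_cast
      ring
  refine (add_le_add (Finset.sum_le_sum hb) (le_of_eq (show _ = (0 : ℝ) by simp))).trans ?_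
  rw [← Finset.mul_sum, Finset.sum_add_distrib, hH', add_zero]
  nlinarith

theorem spv_prime (g : SchwartzMap ℝ ℝ) (p : ℕ) [Fact p.Prime] (hp : 3 ≤ p) (Q : ℝ)
    (hQ : 0 < Q) :
    |∑' t : ℤ, (jacobiSym t p : ℝ) * g ((t : ℝ) / Q)| ≤
      (∫ x, |deriv g x|) * Real.sqrt p * Real.log p := by
  set V := ∫ x, |deriv g x| with hV
  have hV0 : 0 ≤ V := MeasureTheory.integral_nonneg fun _ => abs_nonneg _
  have hp0 : (0 : ℝ) < p := by positivity
  have hchar : ringChar (ZMod p) ≠ 2 := by rw [ZMod.ringChar_zmod_n]; omega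
  set χ : MulChar (ZMod p) ℂ := (quadraticChar (ZMod p)).ringHomComp (Int.castRingHom ℂ) with hχ
  have hχ1 : χ ≠ 1 :=
    (MulChar.ringHomComp_ne_one_iff (RingHom.injective_int _)).mpr (quadraticChar_ne_one hchar)
  have hχq : χ.IsQuadratic := (quadraticChar_isQuadratic (ZMod p)).comp _
  set τ := gaussSum χ (ZMod.stdAddChar (N := p)) with hτ
  have hχv : ∀ t : ℤ, χ (t : ZMod p) = (jacobiSym t p : ℂ) := by
    intro t
    rw [← jacobiSym.legendreSym.to_jacobiSym]
    rfl
  have hχn : ∀ a, ‖χ a‖ ≤ 1 := by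
    intro a
    rcases hχq a with h | h | h <;> simp [h]
  have hτn : ‖τ‖ = Real.sqrt p := by
    have h := gaussSum_sq hχ1 hχq (ZMod.isPrimitive_stdAddChar p)
    have h' := congrArg norm h
    have h1 : ‖χ (-1)‖ = 1 := by
      have := congrArg norm (show χ (-1) * χ (-1) = 1 by rw [← map_mul]; simp)
      rw [norm_mul, norm_one] at this
      nlinarith [norm_nonneg (χ (-1))]
    rw [norm_pow, norm_mul, h1, one_mul, ZMod.card, Complex.norm_natCast] at h'
    rw [← h', Real.sqrt_sq (norm_nonneg _)]
  have hexp : ∀ t : ℤ, (jacobiSym t p : ℂ) * τ =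
      ∑ a : ZMod p, χ a * ZMod.stdAddChar a ^ t := by
    intro t
    have h1 : ∀ a : ZMod p, ZMod.stdAddChar a ^ t = ZMod.stdAddChar ((t : ZMod p) * a) := by
      intro a
      rw [← AddChar.map_zsmul_eq_zpow, zsmul_eq_mul]
    simp only [h1]
    rw [← hχv]
    by_cases h0 : (t : ZMod p) = 0
    · rw [h0]
      simp only [zero_mul, AddChar.map_zero_eq_one, mul_one]
      rw [MulChar.sum_eq_zero_of_ne_one hχ1, MulChar.map_zero, zero_mul]
    · have h2 := gaussSum_mulShift_eq χ (ZMod.stdAddChar (N := p)) (Units.mk0 _ h0)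
      rw [hχq.inv] at h2
      simp only [Units.val_mk0] at h2
      rw [hτ, ← h2]
      rfl
  have hg := spv_summable g Q hQ
  obtain ⟨hv1, hv2⟩ := spv_variation g Q hQ
  have hn : ∀ a : ZMod p, ‖(ZMod.stdAddChar a : ℂ)‖ = 1 := by
    intro a; rw [ZMod.stdAddChar_apply]; exact Circle.norm_coe _
  have hsa : ∀ a : ZMod p, Summable
      (fun t : ℤ => χ a * (ZMod.stdAddChar a ^ t * (g ((t : ℝ) / Q) : ℂ))) := by
    intro a
    refine Summable.mul_left _ (Summable.of_norm ?_)
    simpa [hn] using hg.abs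
  have hmain : ((∑' t : ℤ, (jacobiSym t p : ℝ) * g ((t : ℝ) / Q) : ℝ) : ℂ) * τ =
      ∑ a : ZMod p, χ a * ∑' t : ℤ, ZMod.stdAddChar a ^ t * (g ((t : ℝ) / Q) : ℂ) := by
    simp_rw [← tsum_mul_left]
    rw [← Summable.tsum_finsetSum (fun a _ => hsa a), Complex.ofReal_tsum, ← tsum_mul_right]
    refine tsum_congr fun t => ?_
    push_cast
    rw [mul_right_comm, hexp t, Finset.sum_mul]
    exact Finset.sum_congr rfl fun a _ => by ring
  have hbd : ∀ a : ZMod p,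
      ‖χ a * ∑' t : ℤ, ZMod.stdAddChar a ^ t * (g ((t : ℝ) / Q) : ℂ)‖ ≤
        V * ‖(ZMod.stdAddChar a : ℂ) - 1‖⁻¹ := by
    intro a
    by_cases h0 : a = 0
    · subst h0
      rw [MulChar.map_zero, zero_mul, norm_zero]
      positivity
    · have hne : 0 < ‖(ZMod.stdAddChar a : ℂ) - 1‖ := by
        rw [norm_pos_iff, sub_ne_zero]
        intro h
        apply h0
        apply ZMod.injective_stdAddChar
        rw [h, AddChar.map_zero_eq_one]
      have h1 := (spv_abel (fun t : ℤ => g ((t : ℝ) / Q)) hg hv1 _ (hn a)).trans hv2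
      rw [norm_mul, ← div_eq_mul_inv, le_div_iff₀ hne]
      have h2 := mul_le_mul_of_nonneg_right (hχn a)
        (norm_nonneg (∑' t : ℤ, ZMod.stdAddChar a ^ t * (g ((t : ℝ) / Q) : ℂ)))
      have h3 := mul_le_mul_of_nonneg_right h2 hne.le
      linarith
  have hfin := congrArg norm hmain
  rw [norm_mul, Complex.norm_real, Real.norm_eq_abs, hτn] at hfin
  have h4 : |∑' t : ℤ, (jacobiSym t p : ℝ) * g ((t : ℝ) / Q)| * Real.sqrt p ≤
      V * (p * Real.log p) := by
    rw [hfin]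
    refine (norm_sum_le _ _).trans ((Finset.sum_le_sum fun a _ => hbd a).trans ?_)
    rw [← Finset.mul_sum]
    exact mul_le_mul_of_nonneg_left (spv_sum p hp) hV0
  have hsp : 0 < Real.sqrt p := Real.sqrt_pos.mpr hp0
  refine le_of_mul_le_mul_right (h4.trans (le_of_eq ?_)) hsp
  have := Real.mul_self_sqrt hp0.le
  linear_combination (-V * Real.log p) * this

/-- Smoothed Pólya–Vinogradov: for a Schwartz function `g`,
`|∑_{t∈ℤ} (t|p) g(t/Q)| ≤ C √p log p` uniformly over odd primes `p` and `Q > 0`. -/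
theorem smoothed_polya_vinogradov (g : SchwartzMap ℝ ℝ) :
    ∃ C : ℝ, 0 < C ∧ ∀ p : ℕ, p.Prime → Odd p → ∀ Q : ℝ, 0 < Q →
      |∑' t : ℤ, (jacobiSym t p : ℝ) * g ((t : ℝ) / Q)| ≤ C * Real.sqrt p * Real.log p := by
  have hV0 : 0 ≤ ∫ x, |deriv g x| := MeasureTheory.integral_nonneg fun _ => abs_nonneg _
  refine ⟨(∫ x, |deriv g x|) + 1, by linarith, ?_⟩
  intro p hp hodd Q hQ
  haveI : Fact p.Prime := ⟨hp⟩
  have h3 : 3 ≤ p := by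
    have := hp.two_le
    rcases hodd with ⟨k, hk⟩
    omega
  refine (spv_prime g p h3 Q hQ).trans ?_
  have hl : 0 ≤ Real.log p := Real.log_natCast_nonneg p
  gcongr
  linarith
end
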